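/- arXiv:2510.11102 — 9 statements merged into one kernel-verified Lean document; each statement's English description precedes it below -/
import Mathlib

section
/- Let M and L be c-utility act sets on K. Then M values information more than L (i.e., VoI_M(q) ≥ VoI_L(q) for every information structure q on every probability space) if and only if the function p ↦ h_M(p) − h_L(p) is convex on Δ(K). -/
open MeasureTheory Pointwise

/-- The pairing `⟨p, x⟩ = ∑ k, p k * x k`. -/
def pairing {K : Type} [Fintype K] (p x : K → ℝ) : ℝ := ∑ k, p k * x k

/-- The simplex of beliefs `Δ(K)`. -/
def simplexSet (K : Type) [Fintype K] : Set (K → ℝ) :=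
  {p | (∀ k, 0 ≤ p k) ∧ ∑ k, p k = 1}

/-- The negative orthant `ℝ₋^K`. -/
def negOrthant (K : Type) [Fintype K] : Set (K → ℝ) := {v | ∀ k, v k ≤ 0}

/-- The restricted support function `h_G`. -/
noncomputable def suppFn {K : Type} [Fintype K] (G : Set (K → ℝ)) (p : K → ℝ) : ℝ :=
  sSup ((fun g => pairing p g) '' G)

/-- A c-utility act set: nonempty, closed, convex, comprehensive, with
`{⟨p, g⟩ : g ∈ G}` bounded above for each belief `p`, and `h_G` continuous on the simplex. -/
def IsCUAS {K : Type} [Fintype K] (G : Set (K → ℝ)) : Prop :=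
  G.Nonempty ∧ IsClosed G ∧ Convex ℝ G ∧
  (∀ g ∈ G, ∀ v ∈ negOrthant K, g + v ∈ G) ∧
  (∀ p ∈ simplexSet K, BddAbove ((fun g => pairing p g) '' G)) ∧
  ContinuousOn (suppFn G) (simplexSet K)

/-- The value of information of information structure `q` for decision maker `G`. -/
noncomputable def VoI {K : Type} [Fintype K] (G : Set (K → ℝ)) {Ω : Type}
    [MeasurableSpace Ω] (ℙ : Measure Ω) (q : Ω → K → ℝ) : ℝ :=
  (∫ ω, suppFn G (q ω) ∂ℙ) - suppFn G (∫ ω, q ω ∂ℙ)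

theorem convex_simplexSet (K : Type) [Fintype K] : Convex ℝ (simplexSet K) :=
  convex_stdSimplex ℝ K

theorem isCompact_simplexSet (K : Type) [Fintype K] : IsCompact (simplexSet K) :=
  isCompact_stdSimplex ℝ K

/-- A continuous function on a compact set, composed with a measurable map into that set, is
integrable with respect to any finite measure. -/
theorem ContinuousOn.integrable_comp_of_isCompact {Ω E F : Type*} [MeasurableSpace Ω]
    [TopologicalSpace E] [T2Space E] [MeasurableSpace E] [BorelSpace E]
    [NormedAddCommGroup F] [SecondCountableTopology F]
    {μ : Measure Ω} [IsFiniteMeasure μ] {s : Set E} {f : E → F} {q : Ω → E}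
    (hf : ContinuousOn f s) (hs : IsCompact s) (hq : Measurable q) (hqs : ∀ ω, q ω ∈ s) :
    Integrable (fun ω => f (q ω)) μ := by
  borelize F
  obtain ⟨C, hC⟩ := hs.exists_bound_of_continuousOn hf
  have hm : Measurable (fun ω => f (q ω)) :=
    (continuousOn_iff_continuous_domRestrict.mp hf).measurable.comp (hq.subtype_mk (h := hqs))
  exact Integrable.of_bound hm.aestronglyMeasurable C (ae_of_all _ fun ω => hC _ (hqs ω))

/-- Integral against a two-point measure on `Bool`. -/
theorem integral_two_point {E : Type*} [NormedAddCommGroup E] [NormedSpace ℝ E] [CompleteSpace E]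
    {a b : ℝ} (ha : 0 ≤ a) (hb : 0 ≤ b) (f : Bool → E) :
    ∫ ω, f ω ∂(ENNReal.ofReal a • Measure.dirac true + ENNReal.ofReal b • Measure.dirac false) =
      a • f true + b • f false := by
  have hi (c : ℝ) (i : Bool) : Integrable f (ENNReal.ofReal c • Measure.dirac i) :=
    (Integrable.of_finite).smul_measure ENNReal.ofReal_ne_top
  rw [integral_add_measure (hi _ _) (hi _ _), integral_smul_measure, integral_smul_measure,
    integral_dirac, integral_dirac, ENNReal.toReal_ofReal ha, ENNReal.toReal_ofReal hb]

theorem valuesInformationMore_iff_convex_difference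
    {K : Type} [Fintype K] [Nonempty K] (M L : Set (K → ℝ))
    (hM : IsCUAS M) (hL : IsCUAS L) :
    (∀ (Ω : Type) [MeasurableSpace Ω] (ℙ : Measure Ω), IsProbabilityMeasure ℙ →
      ∀ q : Ω → K → ℝ, Measurable q → (∀ ω, q ω ∈ simplexSet K) →
        VoI L ℙ q ≤ VoI M ℙ q)
    ↔ ConvexOn ℝ (simplexSet K) (fun p => suppFn M p - suppFn L p) := by
  constructor
  · intro h
    refine ⟨convex_simplexSet K, fun x hx y hy a b ha hb hab => ?_⟩
    have hV := h Bool (ENNReal.ofReal a • Measure.dirac true + ENNReal.ofReal b • Measure.dirac false)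
      ⟨by simp [← ENNReal.ofReal_add ha hb, hab]⟩ (fun i => if i then x else y)
      (measurable_of_finite _) (by rintro (_ | _) <;> simp [hx, hy])
    simp only [VoI, integral_two_point ha hb, if_true, Bool.false_eq_true, if_false,
      smul_eq_mul] at hV ⊢
    linarith
  · intro h Ω _ ℙ _ q hq hqs
    have hMc : ContinuousOn (suppFn M) (simplexSet K) := hM.2.2.2.2.2
    have hLc : ContinuousOn (suppFn L) (simplexSet K) := hL.2.2.2.2.2
    have hs := isCompact_simplexSet K
    have hMi := hMc.integrable_comp_of_isCompact (μ := ℙ) hs hq hqs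
    have hLi := hLc.integrable_comp_of_isCompact (μ := ℙ) hs hq hqs
    have hJ := h.map_integral_le (hMc.sub hLc) hs.isClosed (ae_of_all ℙ hqs)
      (continuousOn_id.integrable_comp_of_isCompact hs hq hqs) (hMi.sub hLi)
    simp only [integral_sub hMi hLi] at hJ
    unfold VoI
    linarith
end

section
/- Let M and L be c-utility act sets on K. The following are equivalent: (i) M values information more than L, i.e., VoI_M(q) ≥ VoI_L(q) for every information structure q on every probability space; (ii) M values information strongly more than L, i.e., for every probability space (Ω, 𝓕, ℙ), every information structure q, every sub-σ-algebra 𝒢 of 𝓕, and every 𝒢-measurable map q' : Ω → ℝ^K taking values in Δ(K) and ℙ-almost everywhere equal to the conditional expectation E[q | 𝒢], one has ∫ h_M(q) dℙ − ∫ h_M(q') dℙ ≥ ∫ h_L(q) dℙ − ∫ h_L(q') dℙ. -/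
open MeasureTheory Pointwise

theorem integrable_comp_of_continuousOn_simplexSet {K : Type} [Fintype K] {Ω : Type*}
    {_ : MeasurableSpace Ω} {ℙ : Measure Ω} [IsFiniteMeasure ℙ] {E : Type*} [NormedAddCommGroup E]
    {f : (K → ℝ) → E} (hf : ContinuousOn f (simplexSet K)) {q : Ω → K → ℝ}
    (hq : Measurable q) (hqs : ∀ ω, q ω ∈ simplexSet K) :
    Integrable (fun ω => f (q ω)) ℙ := by
  obtain ⟨C, hC⟩ := (isCompact_stdSimplex ℝ K).exists_bound_of_continuousOn hf
  refine Integrable.of_bound ?_ C (.of_forall fun ω => hC _ (hqs ω))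
  have hq_sub : Measurable (fun ω => (⟨q ω, hqs ω⟩ : simplexSet K)) := hq.subtype_mk
  exact (hf.domRestrict.stronglyMeasurable.comp_measurable hq_sub).aestronglyMeasurable

theorem integrable_of_forall_mem_simplexSet {K : Type} [Fintype K] {Ω : Type*}
    {_ : MeasurableSpace Ω} {ℙ : Measure Ω} [IsFiniteMeasure ℙ] {q : Ω → K → ℝ}
    (hq : Measurable q) (hqs : ∀ ω, q ω ∈ simplexSet K) : Integrable q ℙ :=
  integrable_comp_of_continuousOn_simplexSet continuousOn_id hq hqs

/-- The Bernoulli measure on `Bool` giving weight `a` to `true` and weight `b` to `false`. -/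
noncomputable def boolMeasure (a b : ℝ) : Measure Bool :=
  ENNReal.ofReal a • Measure.dirac true + ENNReal.ofReal b • Measure.dirac false

theorem isProbabilityMeasure_boolMeasure {a b : ℝ} (ha : 0 ≤ a) (hb : 0 ≤ b) (hab : a + b = 1) :
    IsProbabilityMeasure (boolMeasure a b) :=
  ⟨by simp [boolMeasure, ← ENNReal.ofReal_add ha hb, hab]⟩

theorem integral_boolMeasure {E : Type*} [NormedAddCommGroup E] [NormedSpace ℝ E]
    [CompleteSpace E] {a b : ℝ} (ha : 0 ≤ a) (hb : 0 ≤ b) (f : Bool → E) :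
    ∫ ω, f ω ∂(boolMeasure a b) = a • f true + b • f false := by
  have h (c : ℝ) (i : Bool) : Integrable f (ENNReal.ofReal c • Measure.dirac i) :=
    (integrable_dirac (by simp)).smul_measure ENNReal.ofReal_ne_top
  rw [boolMeasure, integral_add_measure (h _ _) (h _ _)]
  simp [integral_smul_measure, ha, hb]

/-- If `M` values information more than `L`, then `h_M - h_L` is convex on the simplex. -/
theorem convexOn_suppFn_sub_of_valuesInformationMore {K : Type} [Fintype K] {M L : Set (K → ℝ)}
    (h : ∀ (Ω : Type) [MeasurableSpace Ω] (ℙ : Measure Ω), IsProbabilityMeasure ℙ →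
      ∀ q : Ω → K → ℝ, Measurable q → (∀ ω, q ω ∈ simplexSet K) → VoI L ℙ q ≤ VoI M ℙ q) :
    ConvexOn ℝ (simplexSet K) (fun p => suppFn M p - suppFn L p) := by
  refine ⟨convex_stdSimplex ℝ K, fun x hx y hy a b ha hb hab => ?_⟩
  have key := h Bool (boolMeasure a b) (isProbabilityMeasure_boolMeasure ha hb hab)
    (fun i => if i then x else y) (measurable_of_countable _) (by simp [hx, hy])
  simp only [VoI, integral_boolMeasure ha hb, smul_eq_mul, if_true, Bool.false_eq_true,
    if_false] at key
  simp only [smul_eq_mul]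
  linarith

theorem valuesInformationMore_iff_valuesInformationStronglyMore
    {K : Type} [Fintype K] [Nonempty K] (M L : Set (K → ℝ))
    (hM : IsCUAS M) (hL : IsCUAS L) :
    (∀ (Ω : Type) [MeasurableSpace Ω] (ℙ : Measure Ω), IsProbabilityMeasure ℙ →
      ∀ q : Ω → K → ℝ, Measurable q → (∀ ω, q ω ∈ simplexSet K) →
        VoI L ℙ q ≤ VoI M ℙ q)
    ↔
    (∀ (Ω : Type) [m : MeasurableSpace Ω] (ℙ : Measure Ω), IsProbabilityMeasure ℙ →
      ∀ q : Ω → K → ℝ, Measurable q → (∀ ω, q ω ∈ simplexSet K) →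
      ∀ 𝒢 : MeasurableSpace Ω, 𝒢 ≤ m →
      ∀ q' : Ω → K → ℝ, Measurable[𝒢] q' → (∀ ω, q' ω ∈ simplexSet K) →
        q' =ᵐ[ℙ] ℙ[q | 𝒢] →
        (∫ ω, suppFn L (q ω) ∂ℙ) - (∫ ω, suppFn L (q' ω) ∂ℙ) ≤
          (∫ ω, suppFn M (q ω) ∂ℙ) - (∫ ω, suppFn M (q' ω) ∂ℙ)) := by
  constructor
  · intro h Ω m ℙ _ q hq hqs
    have hM_int {r : Ω → K → ℝ} (hr : Measurable r) (hrs : ∀ ω, r ω ∈ simplexSet K) :=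
      integrable_comp_of_continuousOn_simplexSet (ℙ := ℙ) hM.2.2.2.2.2 hr hrs
    have hL_int {r : Ω → K → ℝ} (hr : Measurable r) (hrs : ∀ ω, r ω ∈ simplexSet K) :=
      integrable_comp_of_continuousOn_simplexSet (ℙ := ℙ) hL.2.2.2.2.2 hr hrs
    intro 𝒢 h𝒢 q' hq' hqs' hqq'
    have hq'm : Measurable[m] q' := hq'.mono h𝒢 le_rfl
    have hint := (hM_int hq hqs).sub (hL_int hq hqs)
    have jensen := (convexOn_suppFn_sub_of_valuesInformationMore h).map_condExp_le h𝒢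
      (hM.2.2.2.2.2.sub hL.2.2.2.2.2).lowerSemicontinuousOn (.of_forall hqs)
      (isCompact_stdSimplex ℝ K).isClosed (integrable_of_forall_mem_simplexSet hq hqs) hint
    have hle : ∫ ω, suppFn M (q' ω) - suppFn L (q' ω) ∂ℙ ≤
        ∫ ω, suppFn M (q ω) - suppFn L (q ω) ∂ℙ := by
      refine le_of_le_of_eq (integral_mono_ae ((hM_int hq'm hqs').sub (hL_int hq'm hqs'))
        integrable_condExp ?_) (integral_condExp h𝒢)
      filter_upwards [jensen, hqq'] with ω hω heq
      rw [heq]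
      exact hω
    rw [integral_sub (hM_int hq'm hqs') (hL_int hq'm hqs'),
      integral_sub (hM_int hq hqs) (hL_int hq hqs)] at hle
    linarith
  · intro h Ω _ ℙ _ q hq hqs
    have hmean : ∫ ω, q ω ∂ℙ ∈ simplexSet K :=
      (convex_stdSimplex ℝ K).integral_mem (isCompact_stdSimplex ℝ K).isClosed (.of_forall hqs)
        (integrable_of_forall_mem_simplexSet hq hqs)
    simpa [VoI] using h Ω ℙ inferInstance q hq hqs ⊥ bot_le (fun _ => ∫ ω, q ω ∂ℙ)
      measurable_const (fun _ => hmean) (by rw [condExp_bot])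
end

section
/- Let M and L be c-utility act sets on K and suppose there exists a c-utility act set T with M = L + T (Minkowski sum). Then the star-difference S := {x ∈ ℝ^K : ∀ l ∈ L, x + l ∈ M} (i.e., the set of x with x + L ⊆ M) is itself a c-utility act set, and M = L + S. -/
open MeasureTheory Pointwise

theorem pairing_add_right {K : Type} [Fintype K] (p x y : K → ℝ) :
    pairing p (x + y) = pairing p x + pairing p y := by
  simp [pairing, mul_add, Finset.sum_add_distrib]

/-- Membership in a c-utility act set is detected by its restricted support function. -/
theorem IsCUAS.mem_of_pairing_le_suppFn {K : Type} [Fintype K] {T : Set (K → ℝ)}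
    (hT : IsCUAS T) {x : K → ℝ} (hx : ∀ p ∈ simplexSet K, pairing p x ≤ suppFn T p) :
    x ∈ T := by
  classical
  obtain ⟨⟨t, ht⟩, hclosed, hconvex, hcomp, -, -⟩ := hT
  by_contra hxT
  obtain ⟨f, u, hfT, hfx⟩ := geometric_hahn_banach_closed_point hconvex hclosed hxT
  set c : K → ℝ := fun k => f (Pi.single k 1) with hc
  have hf : ∀ y, f y = pairing c y := by
    intro y
    have h := f.toLinearMap.pi_apply_eq_sum_univ y
    simp only [ContinuousLinearMap.coe_coe, smul_eq_mul] at h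
    rw [h, pairing]
    refine Finset.sum_congr rfl fun k _ => ?_
    rw [mul_comm, hc]
    congr 2
    ext j
    simp [Pi.single_apply, eq_comm]
  have hc_nonneg : ∀ k, 0 ≤ c k := by
    intro k
    by_contra! hk
    have hft := hfT t ht
    have hr : 0 ≤ (u - f t) / (-c k) := div_nonneg (by linarith) (by linarith)
    have hmem : t + (-((u - f t) / (-c k))) • Pi.single k (1 : ℝ) ∈ T := by
      refine hcomp t ht _ fun j => ?_
      by_cases hj : j = k
      · subst hj
        simpa using hr
      · simp [hj]
    have h := hfT _ hmem
    rw [map_add, map_smul, smul_eq_mul] at h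
    change f t + -((u - f t) / (-c k)) * c k < u at h
    have : -((u - f t) / (-c k)) * c k = u - f t := by
      field_simp [hk.ne]
    linarith
  have hs_pos : 0 < ∑ k, c k := by
    refine (Finset.sum_nonneg fun k _ => hc_nonneg k).lt_of_ne fun h => ?_
    have hzero : ∀ k, c k = 0 := fun k =>
      (Finset.sum_eq_zero_iff_of_nonneg fun k _ => hc_nonneg k).1 h.symm k (Finset.mem_univ k)
    have hfzero : ∀ y, f y = 0 := fun y => by simp [hf, pairing, hzero]
    have := hfT t ht
    rw [hfzero] at this hfx
    linarith
  set s := ∑ k, c k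
  have hp : (fun k => c k / s) ∈ simplexSet K :=
    ⟨fun k => div_nonneg (hc_nonneg k) hs_pos.le, by
      rw [← Finset.sum_div]; exact div_self hs_pos.ne'⟩
  have hpf : ∀ y, pairing (fun k => c k / s) y = f y / s := fun y => by
    simp [hf, pairing, Finset.sum_div, div_mul_eq_mul_div]
  have hsup : suppFn T (fun k => c k / s) ≤ u / s := by
    refine csSup_le (Set.Nonempty.image _ ⟨t, ht⟩) ?_
    rintro _ ⟨y, hy, rfl⟩
    change pairing (fun k => c k / s) y ≤ u / s
    rw [hpf]
    exact div_le_div_of_nonneg_right (hfT y hy).le hs_pos.le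
  have h := (hx _ hp).trans hsup
  rw [hpf] at h
  exact absurd h (not_le.2 (div_lt_div_of_pos_right hfx hs_pos))

/-- The star-difference of a Minkowski sum `L + T` by `L` recovers `T`. -/
theorem starDifference_add_eq {K : Type} [Fintype K] {L T : Set (K → ℝ)}
    (hL : IsCUAS L) (hT : IsCUAS T) : {x : K → ℝ | ∀ l ∈ L, x + l ∈ L + T} = T := by
  refine Set.Subset.antisymm (fun x hx => ?_) fun x hx l hl => ?_
  · refine hT.mem_of_pairing_le_suppFn fun p hp => ?_
    have h : suppFn L p ≤ suppFn L p + suppFn T p - pairing p x := by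
      refine csSup_le (hL.1.image _) ?_
      rintro _ ⟨l, hl, rfl⟩
      obtain ⟨l', hl', t, ht, hlt⟩ := Set.mem_add.1 (hx l hl)
      have h1 : pairing p l' ≤ suppFn L p :=
        le_csSup (hL.2.2.2.2.1 p hp) (Set.mem_image_of_mem _ hl')
      have h2 : pairing p t ≤ suppFn T p :=
        le_csSup (hT.2.2.2.2.1 p hp) (Set.mem_image_of_mem _ ht)
      have h3 := congrArg (pairing p) hlt
      rw [pairing_add_right, pairing_add_right] at h3
      change pairing p l ≤ _
      linarith
    linarith
  · rw [add_comm x l]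
    exact Set.add_mem_add hl hx

theorem starDifference_isCUAS_and_decomposition
    {K : Type} [Fintype K] [Nonempty K] (M L : Set (K → ℝ))
    (hM : IsCUAS M) (hL : IsCUAS L)
    (hMT : ∃ T : Set (K → ℝ), IsCUAS T ∧ M = L + T) :
    IsCUAS {x : K → ℝ | ∀ l ∈ L, x + l ∈ M} ∧
      M = L + {x : K → ℝ | ∀ l ∈ L, x + l ∈ M} := by
  obtain ⟨T, hT, rfl⟩ := hMT
  rw [starDifference_add_eq hL hT]
  exact ⟨hT, rfl⟩
end

section
/- Let G be a c-utility act set on K, (Ω, 𝓕, ℙ) a probability space, q an information structure, 𝒢 a sub-σ-algebra of 𝓕, and q' : Ω → ℝ^K a 𝒢-measurable map taking values in Δ(K) and ℙ-almost everywhere equal to the conditional expectation E[q | 𝒢]. Then ∫ q' dℙ = ∫ q dℙ, the relative value of information ∫ h_G(q) dℙ − ∫ h_G(q') dℙ is a nonnegative real number, and it equals VoI_G(q) − VoI_G(q'). -/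
open MeasureTheory Pointwise

/-- The restricted support function of a nonempty set that is bounded above in every direction of
the simplex is convex there. -/
theorem convexOn_suppFn {K : Type} [Fintype K] {G : Set (K → ℝ)} (hne : G.Nonempty)
    (hbdd : ∀ p ∈ simplexSet K, BddAbove ((fun g => pairing p g) '' G)) :
    ConvexOn ℝ (simplexSet K) (suppFn G) := by
  refine ⟨convex_stdSimplex ℝ K, fun p hp r hr a b ha hb _ => ?_⟩
  refine csSup_le (hne.image _) ?_
  rintro _ ⟨g, hg, rfl⟩
  have hpg : pairing p g ≤ suppFn G p := le_csSup (hbdd p hp) ⟨g, hg, rfl⟩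
  have hrg : pairing r g ≤ suppFn G r := le_csSup (hbdd r hr) ⟨g, hg, rfl⟩
  have hlin : pairing (a • p + b • r) g = a * pairing p g + b * pairing r g := by
    simp only [pairing, Finset.mul_sum, ← Finset.sum_add_distrib]
    refine Finset.sum_congr rfl fun k _ => ?_
    simp only [Pi.add_apply, Pi.smul_apply, smul_eq_mul]
    ring
  simp only [hlin, smul_eq_mul]
  gcongr

/-- A function continuous on a compact set, composed with a measurable map into that set, is
integrable for every finite measure. -/
theorem integrable_comp_of_continuousOn_isCompact {Ω E F : Type*} {mΩ : MeasurableSpace Ω}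
    [TopologicalSpace E] [MeasurableSpace E] [BorelSpace E]
    [NormedAddCommGroup F] [MeasurableSpace F] [BorelSpace F] [SecondCountableTopology F]
    {μ : Measure Ω} [IsFiniteMeasure μ] {s : Set E} (hs : IsCompact s) {φ : E → F}
    (hφ : ContinuousOn φ s) {f : Ω → E} (hf : Measurable f) (hfs : ∀ ω, f ω ∈ s) :
    Integrable (fun ω => φ (f ω)) μ := by
  obtain ⟨C, hC⟩ := hs.exists_bound_of_continuousOn hφ
  have hmeas : Measurable fun ω => φ (f ω) :=
    (continuousOn_iff_continuous_domRestrict.1 hφ).measurable.comp (hf.subtype_mk (h := hfs))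
  exact .of_bound hmeas.aestronglyMeasurable C (ae_of_all _ fun ω => hC _ (hfs ω))

theorem relative_value_of_information
    {K : Type} [Fintype K] [Nonempty K] (G : Set (K → ℝ)) (hG : IsCUAS G)
    (Ω : Type) [m : MeasurableSpace Ω] (ℙ : Measure Ω) [IsProbabilityMeasure ℙ]
    (q : Ω → K → ℝ) (hq : Measurable q) (hqΔ : ∀ ω, q ω ∈ simplexSet K)
    (𝒢 : MeasurableSpace Ω) (h𝒢 : 𝒢 ≤ m)
    (q' : Ω → K → ℝ) (hq' : Measurable[𝒢] q') (hq'Δ : ∀ ω, q' ω ∈ simplexSet K)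
    (hce : q' =ᵐ[ℙ] ℙ[q | 𝒢]) :
    (∫ ω, q' ω ∂ℙ) = (∫ ω, q ω ∂ℙ) ∧
    0 ≤ (∫ ω, suppFn G (q ω) ∂ℙ) - (∫ ω, suppFn G (q' ω) ∂ℙ) ∧
    (∫ ω, suppFn G (q ω) ∂ℙ) - (∫ ω, suppFn G (q' ω) ∂ℙ) = @VoI K _ G Ω m ℙ q - @VoI K _ G Ω m ℙ q' := by
  obtain ⟨hne, -, -, -, hbdd, hcont⟩ := hG
  have hcompact : IsCompact (simplexSet K) := isCompact_stdSimplex ℝ K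
  have hmean : (∫ ω, q' ω ∂ℙ) = ∫ ω, q ω ∂ℙ :=
    (integral_congr_ae hce).trans (integral_condExp h𝒢)
  have hq_int : Integrable q ℙ :=
    integrable_comp_of_continuousOn_isCompact hcompact continuousOn_id hq hqΔ
  have hsq_int : Integrable (fun ω => suppFn G (q ω)) ℙ :=
    integrable_comp_of_continuousOn_isCompact hcompact hcont hq hqΔ
  have hsq'_int : Integrable (fun ω => suppFn G (q' ω)) ℙ :=
    integrable_comp_of_continuousOn_isCompact hcompact hcont (hq'.mono h𝒢 le_rfl) hq'Δ
  have hjensen := (convexOn_suppFn hne hbdd).map_condExp_le h𝒢 hcont.lowerSemicontinuousOn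
    (ae_of_all ℙ hqΔ) hcompact.isClosed hq_int hsq_int
  have hle : (∫ ω, suppFn G (q' ω) ∂ℙ) ≤ ∫ ω, suppFn G (q ω) ∂ℙ := by
    rw [← integral_condExp (f := fun ω => suppFn G (q ω)) h𝒢]
    refine integral_mono_ae hsq'_int integrable_condExp ?_
    filter_upwards [hjensen, hce] with ω h₁ h₂
    rw [h₂]
    exact h₁
  refine ⟨hmean, sub_nonneg.2 hle, ?_⟩
  simp only [VoI, hmean]
  ring
end

section
/- Let A and B be nonempty types and U : A → K → ℝ, W : B → K → ℝ be utility functions. Define the value functions v_U(p) = sSup {∑_k p k * U a k : a ∈ A}, v_W(p) = sSup {∑_k p k * W b k : b ∈ B}, and the fused value function v(p) = sSup {∑_k p k * (U a k + W b k) : (a, b) ∈ A × B}. Assume that for every p ∈ Δ(K) the sets {∑_k p k * U a k : a ∈ A} and {∑_k p k * W b k : b ∈ B} are bounded above. Then: (i) v(p) = v_U(p) + v_W(p) for every p ∈ Δ(K); (ii) for every probability space (Ω, 𝓕, ℙ) and every measurable q : Ω → ℝ^K taking values in Δ(K) such that v_U ∘ q and v_W ∘ q are ℙ-integrable, one has ∫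 v(q) dℙ − v(∫ q dℙ) = (∫ v_U(q) dℙ − v_U(∫ q dℙ)) + (∫ v_W(q) dℙ − v_W(∫ q dℙ)) ≥ ∫ v_U(q) dℙ − v_U(∫ q dℙ). In words: the fused decision-maker with product decision set and additively separable utility values information more than the original one. -/
open MeasureTheory Pointwise

/-- The value function of a classic decision problem with action set `A` and
utility function `U : A → K → ℝ`. -/
noncomputable def classicValue {K A : Type} [Fintype K] (U : A → K → ℝ) (p : K → ℝ) : ℝ :=
  sSup (Set.range fun a => ∑ k, p k * U a k)

theorem classicValue_prod_add {K A B : Type} [Fintype K] [Nonempty A] [Nonempty B]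
    (U : A → K → ℝ) (W : B → K → ℝ) (p : K → ℝ)
    (hU : BddAbove (Set.range fun a => ∑ k, p k * U a k))
    (hW : BddAbove (Set.range fun b => ∑ k, p k * W b k)) :
    classicValue (fun (ab : A × B) k => U ab.1 k + W ab.2 k) p
      = classicValue U p + classicValue W p := by
  unfold classicValue
  rw [← csSup_add (Set.range_nonempty _) hU (Set.range_nonempty _) hW]
  congr 1
  ext x
  simp [Set.mem_add, mul_add, Finset.sum_add_distrib]

theorem integrable_coord_of_mem_simplexSet {K : Type} [Fintype K] {Ω : Type} [MeasurableSpace Ω]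
    (ℙ : Measure Ω) [IsProbabilityMeasure ℙ] {q : Ω → K → ℝ} (hq : Measurable q)
    (hmem : ∀ ω, q ω ∈ simplexSet K) (k : K) : Integrable (fun ω => q ω k) ℙ := by
  refine Integrable.of_bound (measurable_pi_iff.mp hq k).aestronglyMeasurable 1
    (ae_of_all _ fun ω => ?_)
  rw [Real.norm_of_nonneg ((hmem ω).1 k), ← (hmem ω).2]
  exact Finset.single_le_sum (fun j _ => (hmem ω).1 j) (Finset.mem_univ k)

theorem integral_mem_simplexSet {K : Type} [Fintype K] {Ω : Type} [MeasurableSpace Ω]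
    (ℙ : Measure Ω) [IsProbabilityMeasure ℙ] {q : Ω → K → ℝ} (hq : Measurable q)
    (hmem : ∀ ω, q ω ∈ simplexSet K) : ∫ ω, q ω ∂ℙ ∈ simplexSet K := by
  have hint := integrable_coord_of_mem_simplexSet ℙ hq hmem
  constructor
  · intro k
    rw [eval_integral hint]
    exact integral_nonneg fun ω => (hmem ω).1 k
  · simp_rw [eval_integral hint]
    rw [← integral_finsetSum _ fun k _ => hint k]
    simp [fun ω => (hmem ω).2]

/-- Jensen's inequality for the value function of a classic decision problem. -/
theorem classicValue_integral_le {K B : Type} [Fintype K] [Nonempty B] (W : B → K → ℝ)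
    (hW : ∀ p ∈ simplexSet K, BddAbove (Set.range fun b => ∑ k, p k * W b k))
    {Ω : Type} [MeasurableSpace Ω] (ℙ : Measure Ω) [IsProbabilityMeasure ℙ]
    {q : Ω → K → ℝ} (hq : Measurable q) (hmem : ∀ ω, q ω ∈ simplexSet K)
    (hWq : Integrable (fun ω => classicValue W (q ω)) ℙ) :
    classicValue W (∫ ω, q ω ∂ℙ) ≤ ∫ ω, classicValue W (q ω) ∂ℙ := by
  have hint := integrable_coord_of_mem_simplexSet ℙ hq hmem
  refine csSup_le (Set.range_nonempty _) ?_
  rintro _ ⟨b, rfl⟩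
  have hmul : ∀ k ∈ Finset.univ, Integrable (fun ω => q ω k * W b k) ℙ :=
    fun k _ => (hint k).mul_const _
  simp_rw [eval_integral hint, ← integral_mul_const]
  rw [← integral_finsetSum _ hmul]
  exact integral_mono (integrable_finsetSum _ hmul) hWq
    fun ω => le_csSup (hW _ (hmem ω)) ⟨b, rfl⟩

theorem fusion_makes_information_more_valuable_classic
    {K : Type} [Fintype K] [Nonempty K] {A B : Type} [Nonempty A] [Nonempty B]
    (U : A → K → ℝ) (W : B → K → ℝ)
    (hU : ∀ p ∈ simplexSet K, BddAbove (Set.range fun a => ∑ k, p k * U a k))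
    (hW : ∀ p ∈ simplexSet K, BddAbove (Set.range fun b => ∑ k, p k * W b k)) :
    (∀ p ∈ simplexSet K,
      classicValue (fun (ab : A × B) k => U ab.1 k + W ab.2 k) p
        = classicValue U p + classicValue W p) ∧
    (∀ (Ω : Type) [MeasurableSpace Ω] (ℙ : Measure Ω), IsProbabilityMeasure ℙ →
      ∀ q : Ω → K → ℝ, Measurable q → (∀ ω, q ω ∈ simplexSet K) →
      Integrable (fun ω => classicValue U (q ω)) ℙ →
      Integrable (fun ω => classicValue W (q ω)) ℙ →
      ((∫ ω, classicValue (fun (ab : A × B) k => U ab.1 k + W ab.2 k) (q ω) ∂ℙ)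
            - classicValue (fun (ab : A × B) k => U ab.1 k + W ab.2 k) (∫ ω, q ω ∂ℙ)
          = ((∫ ω, classicValue U (q ω) ∂ℙ) - classicValue U (∫ ω, q ω ∂ℙ))
            + ((∫ ω, classicValue W (q ω) ∂ℙ) - classicValue W (∫ ω, q ω ∂ℙ))) ∧
      (∫ ω, classicValue U (q ω) ∂ℙ) - classicValue U (∫ ω, q ω ∂ℙ)
        ≤ (∫ ω, classicValue (fun (ab : A × B) k => U ab.1 k + W ab.2 k) (q ω) ∂ℙ)
            - classicValue (fun (ab : A × B) k => U ab.1 k + W ab.2 k) (∫ ω, q ω ∂ℙ)) := by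
  have hadd : ∀ p ∈ simplexSet K,
      classicValue (fun (ab : A × B) k => U ab.1 k + W ab.2 k) p
        = classicValue U p + classicValue W p :=
    fun p hp => classicValue_prod_add U W p (hU p hp) (hW p hp)
  refine ⟨hadd, fun Ω _ ℙ _ q hq hmem hUq hWq => ?_⟩
  have hJ := classicValue_integral_le W hW ℙ hq hmem hWq
  simp_rw [fun ω => hadd (q ω) (hmem ω)]
  rw [hadd _ (integral_mem_simplexSet ℙ hq hmem), integral_add hUq hWq]
  constructor <;> linarith
end

section
/- Let G be a c-utility act set on K. Then G coincides with the set cut out by its restricted support function over the simplex: G = {x ∈ ℝ^K : ∀ p ∈ Δ(K), ⟨p, x⟩ ≤ h_G(p)}. -/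
open MeasureTheory Pointwise

theorem dual_apply_eq_pairing {K : Type} [Fintype K] [DecidableEq K]
    (f : StrongDual ℝ (K → ℝ)) (y : K → ℝ) :
    f y = pairing (fun k => f (Pi.single k 1)) y := by
  conv_lhs => rw [pi_eq_sum_univ' y, map_sum]
  refine Finset.sum_congr rfl fun k _ => ?_
  rw [map_smul, smul_eq_mul, mul_comm]

theorem pairing_le_suppFn {K : Type} [Fintype K] {G : Set (K → ℝ)} {p g : K → ℝ}
    (hp : BddAbove ((fun g => pairing p g) '' G)) (hg : g ∈ G) :
    pairing p g ≤ suppFn G p :=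
  le_csSup hp (Set.mem_image_of_mem _ hg)

theorem suppFn_le {K : Type} [Fintype K] {G : Set (K → ℝ)} {p : K → ℝ} {c : ℝ}
    (hG : G.Nonempty) (h : ∀ g ∈ G, pairing p g ≤ c) : suppFn G p ≤ c :=
  csSup_le (hG.image _) (Set.forall_mem_image.2 h)

theorem pairing_smul_left {K : Type} [Fintype K] (c : ℝ) (p x : K → ℝ) :
    pairing (c • p) x = c * pairing p x := by
  simp [pairing, Finset.mul_sum, mul_assoc]

/-- A functional bounded above on a nonempty comprehensive set is nonnegative on the standard
basis. -/
theorem dual_single_nonneg {K : Type} [Fintype K] [DecidableEq K] {G : Set (K → ℝ)}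
    (hne : G.Nonempty) (hcomp : ∀ g ∈ G, ∀ v ∈ negOrthant K, g + v ∈ G)
    {f : StrongDual ℝ (K → ℝ)} {u : ℝ} (hf : ∀ g ∈ G, f g ≤ u) (k : K) :
    0 ≤ f (Pi.single k 1) := by
  by_contra! hk
  obtain ⟨g, hg⟩ := hne
  have hbound (t : ℝ) (ht : 0 ≤ t) : f g - t * f (Pi.single k 1) ≤ u := by
    have hv : -(t • Pi.single k (1 : ℝ)) ∈ negOrthant K := fun j => by
      have : 0 ≤ (Pi.single k (1 : ℝ) : K → ℝ) j :=
        (Pi.single_nonneg.2 zero_le_one : (0 : K → ℝ) ≤ Pi.single k 1) j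
      simpa using mul_nonneg ht this
    simpa [sub_eq_add_neg] using hf _ (hcomp g hg _ hv)
  have hgu := hf g hg
  have h := hbound ((u - f g + 1) / -f (Pi.single k 1))
    (div_nonneg (by linarith) (by linarith))
  rw [div_neg, neg_mul, div_mul_cancel₀ _ hk.ne] at h
  linarith

theorem CUAS_eq_set_cut_out_by_suppFn
    {K : Type} [Fintype K] [Nonempty K] (G : Set (K → ℝ)) (hG : IsCUAS G) :
    G = {x : K → ℝ | ∀ p ∈ simplexSet K, pairing p x ≤ suppFn G p} := by
  classical
  obtain ⟨hne, hclosed, hconv, hcomp, hbdd, -⟩ := hG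
  refine Set.Subset.antisymm (fun g hg p hp => pairing_le_suppFn (hbdd p hp) hg) fun x hx => ?_
  by_contra hxG
  obtain ⟨f, u, hfG, hfx⟩ := geometric_hahn_banach_closed_point hconv hclosed hxG
  set p : K → ℝ := fun k => f (Pi.single k 1)
  have hfp (y : K → ℝ) : f y = pairing p y := dual_apply_eq_pairing f y
  have hp (k : K) : 0 ≤ p k := dual_single_nonneg hne hcomp (fun g hg => (hfG g hg).le) k
  have hsum : 0 < ∑ k, p k := by
    refine (Finset.sum_nonneg fun k _ => hp k).lt_of_ne' fun h => ?_
    have hp0 : ∀ k, p k = 0 := by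
      simpa using (Finset.sum_eq_zero_iff_of_nonneg fun k _ => hp k).1 h
    have hf0 (y : K → ℝ) : f y = 0 := by simp [hfp, pairing, hp0]
    obtain ⟨g, hg⟩ := hne
    have hgu := hfG g hg
    rw [hf0] at hgu hfx
    exact lt_asymm hgu hfx
  have hinv : 0 < (∑ k, p k)⁻¹ := inv_pos.2 hsum
  have hmem : (∑ k, p k)⁻¹ • p ∈ simplexSet K :=
    ⟨fun k => mul_nonneg hinv.le (hp k), by
      simp only [Pi.smul_apply, smul_eq_mul, ← Finset.mul_sum]
      exact inv_mul_cancel₀ hsum.ne'⟩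
  have hle : suppFn G ((∑ k, p k)⁻¹ • p) ≤ (∑ k, p k)⁻¹ * u := suppFn_le hne fun g hg => by
    rw [pairing_smul_left, ← hfp]
    exact mul_le_mul_of_nonneg_left (hfG g hg).le hinv.le
  have hxle := (hx _ hmem).trans hle
  rw [pairing_smul_left, ← hfp] at hxle
  exact hfx.not_ge (le_of_mul_le_mul_left hxle hinv)
end

section
/- Let f : ℝ^K → ℝ be a function that is convex on Δ(K) and lower semicontinuous on Δ(K), and define Θf = {x ∈ ℝ^K : ∀ p ∈ Δ(K), ⟨p, x⟩ ≤ f(p)}. Then Θf is nonempty, closed, convex and comprehensive (Θf + ℝ₋^K ⊆ Θf), and for every p ∈ Δ(K) the set {⟨p, x⟩ : x ∈ Θf} is bounded above with sSup {⟨p, x⟩ : x ∈ Θf} = f(p). -/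
open MeasureTheory Pointwise

/-- The set `Θf` cut out below a function `f` of beliefs. -/
def thetaSet {K : Type} [Fintype K] (f : (K → ℝ) → ℝ) : Set (K → ℝ) :=
  {x | ∀ p ∈ simplexSet K, pairing p x ≤ f p}

theorem isClosed_simplexSet (K : Type) [Fintype K] : IsClosed (simplexSet K) :=
  isClosed_stdSimplex ℝ K

theorem simplexSet_nonempty (K : Type) [Fintype K] [Nonempty K] : (simplexSet K).Nonempty := by
  classical
  exact ⟨_, single_mem_stdSimplex ℝ (Classical.arbitrary K)⟩

/-- On the simplex, every affine function is a linear one. -/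
theorem exists_pairing_eq_affine {K : Type} [Fintype K] (l : (K → ℝ) →L[ℝ] ℝ) (c : ℝ) :
    ∃ x : K → ℝ, ∀ p ∈ simplexSet K, pairing p x = l p + c := by
  classical
  refine ⟨fun k => l (fun j => if k = j then 1 else 0) + c, fun p hp => ?_⟩
  have hl := LinearMap.pi_apply_eq_sum_univ l.toLinearMap p
  simp only [ContinuousLinearMap.coe_coe, smul_eq_mul] at hl
  rw [hl]
  simp only [pairing, mul_add, Finset.sum_add_distrib, ← Finset.sum_mul, hp.2, one_mul]

theorem exists_mem_thetaSet_pairing_eq {K : Type} [Fintype K] {f : (K → ℝ) → ℝ}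
    (hconv : ConvexOn ℝ (simplexSet K) f) (hlsc : LowerSemicontinuousOn f (simplexSet K))
    {p : K → ℝ} (hp : p ∈ simplexSet K) {a : ℝ} (ha : a < f p) :
    ∃ x ∈ thetaSet f, pairing p x = a := by
  obtain ⟨l, c, hle, heq⟩ :=
    hconv.exists_affine_le_of_lt (𝕜 := ℝ) hp ha (isClosed_simplexSet K) hlsc
  obtain ⟨x, hx⟩ := exists_pairing_eq_affine l c
  exact ⟨x, fun q hq => (hx q hq).trans_le (hle ⟨q, hq⟩), (hx p hp).trans heq⟩

theorem isClosed_thetaSet {K : Type} [Fintype K] (f : (K → ℝ) → ℝ) : IsClosed (thetaSet f) := by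
  simp only [thetaSet, Set.ofPred_forall, pairing]
  exact isClosed_iInter fun p => isClosed_iInter fun _ =>
    isClosed_le (by fun_prop) continuous_const

theorem convex_thetaSet {K : Type} [Fintype K] (f : (K → ℝ) → ℝ) : Convex ℝ (thetaSet f) := by
  simp only [thetaSet, Set.ofPred_forall]
  refine convex_iInter fun p => convex_iInter fun _ => convex_halfSpace_le ⟨?_, ?_⟩ _
  · intro x y
    exact dotProduct_add p x y
  · intro c x
    exact dotProduct_smul c p x

theorem thetaSet_add_negOrthant_subset {K : Type} [Fintype K] (f : (K → ℝ) → ℝ) :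
    thetaSet f + negOrthant K ⊆ thetaSet f := by
  rintro _ ⟨x, hx, v, hv, rfl⟩ p hp
  refine (Finset.sum_le_sum fun k _ => ?_).trans (hx p hp)
  exact mul_le_mul_of_nonneg_left (add_le_of_nonpos_right (hv k)) (hp.1 k)

theorem thetaSet_isCUAS_and_suppFn_eq
    {K : Type} [Fintype K] [Nonempty K] (f : (K → ℝ) → ℝ)
    (hconv : ConvexOn ℝ (simplexSet K) f)
    (hlsc : LowerSemicontinuousOn f (simplexSet K)) :
    (thetaSet f).Nonempty ∧ IsClosed (thetaSet f) ∧ Convex ℝ (thetaSet f) ∧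
    thetaSet f + negOrthant K ⊆ thetaSet f ∧
    ∀ p ∈ simplexSet K,
      BddAbove ((fun x => pairing p x) '' thetaSet f) ∧
      sSup ((fun x => pairing p x) '' thetaSet f) = f p := by
  have hne : (thetaSet f).Nonempty := by
    obtain ⟨p, hp⟩ := simplexSet_nonempty K
    obtain ⟨x, hx, -⟩ := exists_mem_thetaSet_pairing_eq hconv hlsc hp (sub_one_lt (f p))
    exact ⟨x, hx⟩
  refine ⟨hne, isClosed_thetaSet f, convex_thetaSet f, thetaSet_add_negOrthant_subset f,
    fun p hp => ?_⟩
  have hub : ∀ a ∈ (fun x => pairing p x) '' thetaSet f, a ≤ f p := by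
    rintro _ ⟨x, hx, rfl⟩
    exact hx p hp
  refine ⟨⟨f p, hub⟩, csSup_eq_of_forall_le_of_forall_lt_exists_gt (hne.image _) hub
    fun r hr => ?_⟩
  obtain ⟨a, hra, ha⟩ := exists_between hr
  obtain ⟨x, hx, hpx⟩ := exists_mem_thetaSet_pairing_eq hconv hlsc hp ha
  exact ⟨a, ⟨x, hx, hpx⟩, hra⟩
end

section
/- Let f : ℝ^K → ℝ be convex on Δ(K) and lower semicontinuous on Δ(K). Then, in (K → ℝ) × ℝ, the closure of the dilated epigraph {(λ • p, λ * t) : λ ∈ ℝ, λ > 0, p ∈ Δ(K), f(p) ≤ t} equals the set ({0} × {s : 0 ≤ s}) ∪ {(y, s) : (∀ k, 0 ≤ y k) ∧ y ≠ 0 ∧ (∑_k y k) * f((∑_k y k)⁻¹ • y) ≤ s}; in particular this latter set, the epigraph of the positively homogeneous extension of f, is a closed convex cone. -/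
open MeasureTheory Pointwise

/-- The epigraph of the positively homogeneous extension of a function `f` of beliefs. -/
def homogEpigraph {K : Type} [Fintype K] (f : (K → ℝ) → ℝ) : Set ((K → ℝ) × ℝ) :=
  ((({0} : Set (K → ℝ)) ×ˢ {s : ℝ | 0 ≤ s}) ∪
    {z | (∀ k, 0 ≤ z.1 k) ∧ z.1 ≠ 0 ∧ (∑ k, z.1 k) * f ((∑ k, z.1 k)⁻¹ • z.1) ≤ z.2})

/-- The cone generated by the epigraph of `f` over the simplex, without its apex. -/
def dilatedEpigraph {K : Type} [Fintype K] (f : (K → ℝ) → ℝ) : Set ((K → ℝ) × ℝ) :=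
  {z | ∃ l : ℝ, 0 < l ∧ ∃ p ∈ simplexSet K, ∃ t : ℝ, f p ≤ t ∧ z = (l • p, l * t)}

section

variable {K : Type} [Fintype K] {f : (K → ℝ) → ℝ}

lemma sum_pos_of_nonneg_of_ne_zero {y : K → ℝ} (hy : ∀ k, 0 ≤ y k) (hy0 : y ≠ 0) :
    0 < ∑ k, y k := by
  obtain ⟨k, hk⟩ := Function.ne_iff.1 hy0
  exact Finset.sum_pos' (fun k _ => hy k) ⟨k, Finset.mem_univ k, (hy k).lt_of_ne' hk⟩

lemma inv_sum_smul_mem_simplexSet {y : K → ℝ} (hy : ∀ k, 0 ≤ y k) (hσ : 0 < ∑ k, y k) :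
    (∑ k, y k)⁻¹ • y ∈ simplexSet K := by
  refine ⟨fun k => mul_nonneg (inv_nonneg.2 hσ.le) (hy k), ?_⟩
  simp [← Finset.mul_sum, hσ.ne']

lemma sum_smul_of_mem_simplexSet {p : K → ℝ} (hp : p ∈ simplexSet K) (l : ℝ) :
    ∑ k, (l • p) k = l := by
  simp [← Finset.mul_sum, hp.2]

lemma mem_dilatedEpigraph_iff {z : (K → ℝ) × ℝ} :
    z ∈ dilatedEpigraph f ↔
      (∀ k, 0 ≤ z.1 k) ∧ z.1 ≠ 0 ∧ (∑ k, z.1 k) * f ((∑ k, z.1 k)⁻¹ • z.1) ≤ z.2 := by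
  constructor
  · rintro ⟨l, hl, p, hp, t, ht, rfl⟩
    have hsum := sum_smul_of_mem_simplexSet hp l
    refine ⟨fun k => mul_nonneg hl.le (hp.1 k), fun h => ?_, ?_⟩
    · rw [show l • p = 0 from h] at hsum
      simp [hl.ne] at hsum
    · simp only [hsum, inv_smul_smul₀ hl.ne']
      gcongr
  · rintro ⟨hz, hz0, hle⟩
    have hσ := sum_pos_of_nonneg_of_ne_zero hz hz0
    refine ⟨_, hσ, _, inv_sum_smul_mem_simplexSet hz hσ, (∑ k, z.1 k)⁻¹ * z.2, ?_, ?_⟩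
    · rwa [le_inv_mul_iff₀ hσ]
    · rw [smul_inv_smul₀ hσ.ne', mul_inv_cancel_left₀ hσ.ne']

lemma homogEpigraph_eq_union :
    homogEpigraph f = ({0} : Set (K → ℝ)) ×ˢ {s : ℝ | 0 ≤ s} ∪ dilatedEpigraph f := by
  ext z
  simp [homogEpigraph, mem_dilatedEpigraph_iff]

lemma smul_mem_dilatedEpigraph {z : (K → ℝ) × ℝ} (hz : z ∈ dilatedEpigraph f) {c : ℝ}
    (hc : 0 < c) : c • z ∈ dilatedEpigraph f := by
  obtain ⟨l, hl, p, hp, t, ht, rfl⟩ := hz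
  exact ⟨c * l, mul_pos hc hl, p, hp, t, ht, by simp [mul_smul, mul_assoc]⟩

lemma smul_mem_homogEpigraph {z : (K → ℝ) × ℝ} (hz : z ∈ homogEpigraph f) {c : ℝ}
    (hc : 0 < c) : c • z ∈ homogEpigraph f := by
  rw [homogEpigraph_eq_union] at hz ⊢
  refine hz.imp (fun h => ⟨?_, ?_⟩) fun h => smul_mem_dilatedEpigraph h hc
  · simp [Set.mem_singleton_iff.1 h.1]
  · exact mul_nonneg hc.le h.2

lemma add_mem_dilatedEpigraph (hconv : ConvexOn ℝ (simplexSet K) f) {z w : (K → ℝ) × ℝ}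
    (hz : z ∈ dilatedEpigraph f) (hw : w ∈ dilatedEpigraph f) : z + w ∈ dilatedEpigraph f := by
  obtain ⟨l, hl, p, hp, t, ht, rfl⟩ := hz
  obtain ⟨m, hm, q, hq, u, hu, rfl⟩ := hw
  have hlm : 0 < l + m := add_pos hl hm
  have ha : 0 ≤ l / (l + m) := by positivity
  have hb : 0 ≤ m / (l + m) := by positivity
  have hab : l / (l + m) + m / (l + m) = 1 := by field_simp
  refine ⟨l + m, hlm, _, hconv.1 hp hq ha hb hab, l / (l + m) * t + m / (l + m) * u, ?_, ?_⟩
  · refine (hconv.2 hp hq ha hb hab).trans ?_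
    simp only [smul_eq_mul]
    gcongr
  · ext
    · simp
      field_simp
    · simp
      field_simp

lemma convex_dilatedEpigraph (hconv : ConvexOn ℝ (simplexSet K) f) :
    Convex ℝ (dilatedEpigraph f) :=
  convex_iff_forall_pos.2 fun _ hz _ hw _ _ ha hb _ =>
    add_mem_dilatedEpigraph hconv (smul_mem_dilatedEpigraph hz ha) (smul_mem_dilatedEpigraph hw hb)

lemma sum_mul_le_of_mem_homogEpigraph {m : ℝ} (hm : ∀ p ∈ simplexSet K, m ≤ f p)
    {z : (K → ℝ) × ℝ} (hz : z ∈ homogEpigraph f) : (∑ k, z.1 k) * m ≤ z.2 := by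
  rw [homogEpigraph_eq_union] at hz
  rcases hz with ⟨h0, hs⟩ | ⟨l, hl, p, hp, t, ht, rfl⟩
  · simpa [Set.mem_singleton_iff.1 h0] using hs
  · simp only [sum_smul_of_mem_simplexSet hp]
    gcongr
    exact (hm p hp).trans ht

lemma isClosed_homogEpigraph (hlsc : LowerSemicontinuousOn f (simplexSet K)) :
    IsClosed (homogEpigraph f) := by
  have hcompact : IsCompact (simplexSet K) := isCompact_stdSimplex ℝ K
  have hepi := (lowerSemicontinuousOn_iff_isClosed_epigraph hcompact.isClosed).1 hlsc
  obtain ⟨m, hm⟩ := hlsc.bddBelow_of_isCompact hcompact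
  refine isClosed_of_closure_subset fun z hz => ?_
  have hnonneg : ∀ k, 0 ≤ z.1 k := fun k => by
    have hcl : IsClosed {w : (K → ℝ) × ℝ | 0 ≤ w.1 k} :=
      isClosed_le continuous_const (by fun_prop)
    refine closure_minimal (fun w hw => ?_) hcl hz
    rcases hw with ⟨h0, -⟩ | hw
    · simp [Set.mem_singleton_iff.1 h0]
    · exact hw.1 k
  have hlower : (∑ k, z.1 k) * m ≤ z.2 := by
    have hcl : IsClosed {w : (K → ℝ) × ℝ | (∑ k, w.1 k) * m ≤ w.2} :=
      isClosed_le (by fun_prop) (by fun_prop)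
    exact closure_minimal (fun w hw => sum_mul_le_of_mem_homogEpigraph
      (fun p hp => hm (Set.mem_image_of_mem f hp)) hw) hcl hz
  rcases eq_or_ne z.1 0 with h0 | h0
  · exact Or.inl ⟨h0, by simpa [h0] using hlower⟩
  refine Or.inr ⟨hnonneg, h0, ?_⟩
  have hσ := sum_pos_of_nonneg_of_ne_zero hnonneg h0
  let φ : (K → ℝ) × ℝ → (K → ℝ) × ℝ :=
    fun w => ((∑ k, w.1 k)⁻¹ • w.1, (∑ k, w.1 k)⁻¹ * w.2)
  have hsum : Continuous fun w : (K → ℝ) × ℝ => ∑ k, w.1 k := by fun_prop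
  have hφ : ContinuousAt φ z :=
    have hinv := hsum.continuousAt.inv₀ hσ.ne'
    (hinv.smul continuousAt_fst).prodMk (hinv.mul continuousAt_snd)
  have hfreq := (mem_closure_iff_frequently.1 hz).and_eventually
    (hsum.continuousAt.eventually (lt_mem_nhds hσ))
  have hmem : φ z ∈ {p : (K → ℝ) × ℝ | p.1 ∈ simplexSet K ∧ f p.1 ≤ p.2} := by
    refine hepi.mem_of_frequently_of_tendsto (hfreq.mono ?_) hφ
    rintro w ⟨⟨hw0, -⟩ | ⟨hw, -, hle⟩, hpos⟩
    · simp [Set.mem_singleton_iff.1 hw0] at hpos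
    · exact ⟨inv_sum_smul_mem_simplexSet hw hpos, (le_inv_mul_iff₀ hpos).2 hle⟩
  exact (le_inv_mul_iff₀ hσ).1 hmem.2

lemma homogEpigraph_subset_closure_dilatedEpigraph [Nonempty K] :
    homogEpigraph f ⊆ closure (dilatedEpigraph f) := by
  rw [homogEpigraph_eq_union]
  refine Set.union_subset ?_ subset_closure
  rintro ⟨y, s⟩ ⟨hy, hs⟩
  obtain rfl : y = 0 := hy
  replace hs : 0 ≤ s := hs
  classical
  obtain ⟨k⟩ := ‹Nonempty K›
  have hp : Pi.single k 1 ∈ simplexSet K := single_mem_stdSimplex ℝ k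
  set p : K → ℝ := Pi.single k 1
  have hcont : Continuous fun l : ℝ => (l • p, l * f p + s) := by fun_prop
  have htendsto : Filter.Tendsto (fun l : ℝ => (l • p, l * f p + s))
      (nhdsWithin 0 (Set.Ioi 0)) (nhds (0, s)) := by
    simpa using (hcont.tendsto 0).mono_left nhdsWithin_le_nhds
  refine mem_closure_of_tendsto htendsto ?_
  filter_upwards [self_mem_nhdsWithin] with l (hl : 0 < l)
  refine ⟨l, hl, p, hp, f p + s / l, le_add_of_nonneg_right (by positivity), ?_⟩
  rw [mul_add, mul_div_cancel₀ _ hl.ne']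

lemma closure_dilatedEpigraph [Nonempty K] (hlsc : LowerSemicontinuousOn f (simplexSet K)) :
    closure (dilatedEpigraph f) = homogEpigraph f := by
  refine (closure_minimal ?_ (isClosed_homogEpigraph hlsc)).antisymm
    homogEpigraph_subset_closure_dilatedEpigraph
  rw [homogEpigraph_eq_union]
  exact Set.subset_union_right

end

theorem closure_dilated_epigraph_eq_homogEpigraph
    {K : Type} [Fintype K] [Nonempty K] (f : (K → ℝ) → ℝ)
    (hconv : ConvexOn ℝ (simplexSet K) f)
    (hlsc : LowerSemicontinuousOn f (simplexSet K)) :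
    closure {z : (K → ℝ) × ℝ | ∃ l : ℝ, 0 < l ∧ ∃ p ∈ simplexSet K, ∃ t : ℝ,
        f p ≤ t ∧ z = (l • p, l * t)}
      = homogEpigraph f ∧
    IsClosed (homogEpigraph f) ∧ Convex ℝ (homogEpigraph f) ∧
    (∀ z ∈ homogEpigraph f, ∀ c : ℝ, 0 < c → c • z ∈ homogEpigraph f) := by
  have hclosure := closure_dilatedEpigraph hlsc
  exact ⟨hclosure, isClosed_homogEpigraph hlsc, hclosure ▸ (convex_dilatedEpigraph hconv).closure,
    fun _ hz _ hc => smul_mem_homogEpigraph hz hc⟩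
end

section
/- For every p ∈ Δ(K), the negentropy admits the support-function representation: sSup { ∑_k p k * x k : x : K → ℝ such that ∑_k Real.exp (x k) ≤ 1 } = ∑_k p k * Real.log (p k) (where, since Real.log 0 = 0, the terms with p k = 0 vanish, matching the convention 0 · log 0 = 0). -/
open MeasureTheory Pointwise

/-- The Fenchel–Young inequality for the exponential function. -/
theorem mul_add_sub_exp_le_mul_log {a : ℝ} (ha : 0 ≤ a) (x : ℝ) :
    a * x + a - Real.exp x ≤ a * Real.log a := by
  rcases ha.eq_or_lt with rfl | ha
  · simpa using (Real.exp_pos x).le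
  · have h := mul_le_mul_of_nonneg_left (Real.add_one_le_exp (x - Real.log a)) ha.le
    rw [Real.exp_sub, Real.exp_log ha, mul_div_cancel₀ _ ha.ne'] at h
    linarith

theorem sum_mul_le_sum_mul_log {K : Type} [Fintype K] {p x : K → ℝ} (hp : p ∈ simplexSet K)
    (hx : ∑ k, Real.exp (x k) ≤ 1) :
    ∑ k, p k * x k ≤ ∑ k, p k * Real.log (p k) := by
  have h := Finset.sum_le_sum fun k (_ : k ∈ Finset.univ) =>
    mul_add_sub_exp_le_mul_log (hp.1 k) (x k)
  rw [Finset.sum_sub_distrib, Finset.sum_add_distrib, hp.2] at h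
  linarith

/-- Mixing `p` with the uniform distribution gives nearly optimal feasible points. -/
theorem exists_sum_exp_le_one_and_sum_mul_log_sub_le {K : Type} [Fintype K] [Nonempty K]
    {p : K → ℝ} (hp : p ∈ simplexSet K) {ε : ℝ} (hε : 0 < ε) :
    ∃ x : K → ℝ, ∑ k, Real.exp (x k) ≤ 1 ∧
      ∑ k, p k * Real.log (p k) - ε ≤ ∑ k, p k * x k := by
  have hs : 0 < Real.exp (-ε) := Real.exp_pos _
  have hs1 : Real.exp (-ε) < 1 := by simpa using hε
  have hcard : (0 : ℝ) < Fintype.card K := Nat.cast_pos.mpr Fintype.card_pos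
  have hu : 0 < (1 - Real.exp (-ε)) / Fintype.card K := div_pos (sub_pos.mpr hs1) hcard
  have hpos (k : K) : 0 < Real.exp (-ε) * p k + (1 - Real.exp (-ε)) / Fintype.card K :=
    add_pos_of_nonneg_of_pos (mul_nonneg hs.le (hp.1 k)) hu
  refine ⟨fun k => Real.log (Real.exp (-ε) * p k + (1 - Real.exp (-ε)) / Fintype.card K), ?_, ?_⟩
  · simp only [Real.exp_log (hpos _)]
    rw [Finset.sum_add_distrib, ← Finset.mul_sum, hp.2, Finset.sum_const, Finset.card_univ,
      nsmul_eq_mul, mul_div_cancel₀ _ hcard.ne']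
    linarith
  · have hsum : ∑ k, p k * Real.log (p k) - ε = ∑ k, p k * (Real.log (p k) - ε) := by
      simp only [mul_sub, Finset.sum_sub_distrib, ← Finset.sum_mul, hp.2, one_mul]
    rw [hsum]
    refine Finset.sum_le_sum fun k _ => ?_
    rcases (hp.1 k).eq_or_lt with hk | hk
    · simp [← hk]
    · refine mul_le_mul_of_nonneg_left ?_ hk.le
      have hlog : Real.log (p k) - ε = Real.log (Real.exp (-ε) * p k) := by
        rw [Real.log_mul hs.ne' hk.ne', Real.log_exp]
        ring
      rw [hlog]
      exact Real.log_le_log (mul_pos hs hk) (le_add_of_nonneg_right hu.le)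

theorem negentropy_support_function_representation
    {K : Type} [Fintype K] [Nonempty K] (p : K → ℝ) (hp : p ∈ simplexSet K) :
    sSup {r : ℝ | ∃ x : K → ℝ, (∑ k, Real.exp (x k)) ≤ 1 ∧ r = ∑ k, p k * x k}
      = ∑ k, p k * Real.log (p k) := by
  obtain ⟨x₀, hx₀, -⟩ := exists_sum_exp_le_one_and_sum_mul_log_sub_le hp one_pos
  refine csSup_eq_of_forall_le_of_forall_lt_exists_gt ⟨_, x₀, hx₀, rfl⟩ ?_ fun w hw => ?_
  · rintro _ ⟨x, hx, rfl⟩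
    exact sum_mul_le_sum_mul_log hp hx
  · obtain ⟨x, hx, hle⟩ :=
      exists_sum_exp_le_one_and_sum_mul_log_sub_le hp (half_pos (sub_pos.mpr hw))
    exact ⟨_, ⟨x, hx, rfl⟩, by linarith⟩
end
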